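/- Let 0 < δ ≤ 1 and let s < −2 + δ. Then the family (k,h) ↦ ‖k‖^{2s−2δ} · ((h^⊥ · k)² / (‖h‖²·‖k‖²)) · (‖k−h‖^{1+δ} − ‖h‖^{1+δ})² / (‖h‖^{2δ}·‖k−h‖^{2+2δ}), indexed by pairs (k,h) ∈ ℤ² × ℤ² with k ≠ 0, h ≠ 0, h ≠ k, is summable; i.e. Σ_{k ≠ 0} ‖k‖^{2s−2δ} Σ_{h ≠ 0, h ≠ k} ((h^⊥ · k)²/(‖h‖²‖k‖²))·(‖k−h‖^{1+δ} − ‖h‖^{1+δ})²/(‖h‖^{2δ}‖k−h‖^{2+2δ}) < ∞. -/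

import Mathlib

/-- The Euclidean norm of a lattice point `k ∈ ℤ²`. -/
noncomputable def znorm (k : ℤ × ℤ) : ℝ := Real.sqrt ((k.1 : ℝ) ^ 2 + (k.2 : ℝ) ^ 2)

/-- `h^⊥ · k` where `h^⊥ = (−h₂, h₁)` and `·` is the standard dot product. -/
def perpDot (h k : ℤ × ℤ) : ℝ := ((-h.2 * k.1 + h.1 * k.2 : ℤ) : ℝ)

lemma znorm_eq_norm (k : ℤ × ℤ) : znorm k = ‖((k.1 : ℝ) : ℂ) + ((k.2 : ℝ) : ℂ) * Complex.I‖ :=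
  (Complex.norm_add_mul_I _ _).symm

lemma abs_znorm_sub_sub_znorm_le (k h : ℤ × ℤ) : |znorm (k - h) - znorm h| ≤ znorm k := by
  rw [znorm_eq_norm, znorm_eq_norm, znorm_eq_norm,
    ← norm_neg (((h.1 : ℝ) : ℂ) + ((h.2 : ℝ) : ℂ) * Complex.I)]
  refine (abs_norm_sub_norm_le _ _).trans_eq ?_
  congr 1
  push_cast [Prod.fst_sub, Prod.snd_sub]
  ring

lemma znorm_nonneg (k : ℤ × ℤ) : 0 ≤ znorm k := Real.sqrt_nonneg _

lemma znorm_sq (k : ℤ × ℤ) : znorm k ^ 2 = (k.1 : ℝ) ^ 2 + (k.2 : ℝ) ^ 2 :=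
  Real.sq_sqrt (by positivity)

lemma norm_le_znorm (k : ℤ × ℤ) : ‖k‖ ≤ znorm k := by
  rw [Prod.norm_def]
  refine max_le ?_ ?_ <;> rw [Int.norm_eq_abs] <;> apply Real.abs_le_sqrt <;> nlinarith

lemma znorm_pos {k : ℤ × ℤ} (hk : k ≠ 0) : 0 < znorm k :=
  (norm_pos_iff.mpr hk).trans_le (norm_le_znorm k)

lemma perpDot_sq_le (h k : ℤ × ℤ) : perpDot h k ^ 2 ≤ znorm h ^ 2 * znorm k ^ 2 := by
  rw [znorm_sq, znorm_sq, perpDot]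
  push_cast
  nlinarith [sq_nonneg ((h.1 : ℝ) * k.1 + h.2 * k.2)]

lemma summable_norm_rpow_int_prod {r : ℝ} (hr : 2 < r) :
    Summable fun k : ℤ × ℤ => ‖k‖ ^ (-r) := by
  refine ((finTwoArrowEquiv ℤ).symm.summable_iff.mpr
    (EisensteinSeries.summable_one_div_norm_rpow hr)).congr fun k => ?_
  simp [EisensteinSeries.norm_eq_max_natAbs, Prod.norm_def, Int.norm_eq_abs, Nat.cast_max]

lemma summable_znorm_rpow {r : ℝ} (hr : r < -2) : Summable fun k : ℤ × ℤ => znorm k ^ r := by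
  refine (summable_norm_rpow_int_prod (r := -r) (by linarith)).of_nonneg_of_le
    (fun k => Real.rpow_nonneg (znorm_nonneg k) _) fun k => ?_
  rw [neg_neg]
  rcases eq_or_ne k 0 with rfl | hk
  · simp [znorm]
  · exact Real.rpow_le_rpow_of_nonpos (norm_pos_iff.mpr hk) (norm_le_znorm k) (by linarith)

lemma rpow_one_add_sub_le {a b δ : ℝ} (ha : 0 < a) (hab : a ≤ b) (hδ1 : δ ≤ 1) :
    b ^ (1 + δ) - a ^ (1 + δ) ≤ (a ^ δ + b ^ δ) * (b - a) := by
  have hb := ha.trans_le hab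
  have hmono : a ^ (1 - δ) ≤ b ^ (1 - δ) := Real.rpow_le_rpow ha.le hab (by linarith)
  have hab' : a * b ^ δ ≤ a ^ δ * b := by
    calc a * b ^ δ = a ^ (1 - δ) * (a ^ δ * b ^ δ) := by
          rw [← mul_assoc, ← Real.rpow_add ha]; simp
      _ ≤ b ^ (1 - δ) * (a ^ δ * b ^ δ) := by gcongr
      _ = a ^ δ * b := by
          rw [mul_left_comm, ← Real.rpow_add hb]; simp
  rw [Real.rpow_add ha, Real.rpow_add hb, Real.rpow_one, Real.rpow_one]
  linarith

lemma sq_rpow_one_add_sub_le {a b δ : ℝ} (ha : 0 < a) (hb : 0 < b) (hδ : 0 ≤ δ) (hδ1 : δ ≤ 1) :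
    (b ^ (1 + δ) - a ^ (1 + δ)) ^ 2 ≤ 2 * (a ^ (2 * δ) + b ^ (2 * δ)) * (b - a) ^ 2 := by
  wlog hab : a ≤ b generalizing a b
  · have := this hb ha (le_of_not_ge hab)
    linarith
  have h0 : 0 ≤ b ^ (1 + δ) - a ^ (1 + δ) :=
    sub_nonneg.mpr (Real.rpow_le_rpow ha.le hab (by linarith))
  have h2 : ∀ x : ℝ, 0 < x → x ^ (2 * δ) = (x ^ δ) ^ 2 := fun x hx => by
    rw [mul_comm, Real.rpow_mul hx.le, Real.rpow_two]
  rw [h2 a ha, h2 b hb]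
  refine (pow_le_pow_left₀ h0 (rpow_one_add_sub_le ha hab hδ1) 2).trans ?_
  rw [mul_pow]
  gcongr
  linarith [sq_nonneg (a ^ δ - b ^ δ)]

lemma rpow_mul_rpow_le_add {a b p q : ℝ} (ha : 0 < a) (hb : 0 < b) (hp : p ≤ 0) (hq : q ≤ 0) :
    a ^ p * b ^ q ≤ a ^ (p + q) + b ^ (p + q) := by
  have hpa := Real.rpow_pos_of_pos ha (p + q)
  have hpb := Real.rpow_pos_of_pos hb (p + q)
  rcases le_total a b with hab | hab
  · have : a ^ p * b ^ q ≤ a ^ p * a ^ q := by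
      gcongr ?_ * ?_
      exact Real.rpow_le_rpow_of_nonpos ha hab hq
    rw [← Real.rpow_add ha] at this
    linarith
  · have : a ^ p * b ^ q ≤ b ^ p * b ^ q := by
      gcongr ?_ * ?_
      exact Real.rpow_le_rpow_of_nonpos hb hab hp
    rw [← Real.rpow_add hb] at this
    linarith

lemma sq_rpow_one_add_sub_div_le {a b K δ : ℝ} (ha : 0 < a) (hb : 0 < b) (hδ : 0 ≤ δ)
    (hδ1 : δ ≤ 1) (hK : |b - a| ≤ K) :
    (b ^ (1 + δ) - a ^ (1 + δ)) ^ 2 / (a ^ (2 * δ) * b ^ (2 + 2 * δ)) ≤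
      4 * K ^ 2 * (a ^ (-2 - 2 * δ) + b ^ (-2 - 2 * δ)) := by
  have hA := Real.rpow_pos_of_pos ha (2 * δ)
  have hB := Real.rpow_pos_of_pos hb (2 * δ)
  have hsq : (b - a) ^ 2 ≤ K ^ 2 := sq_le_sq.mpr (hK.trans (le_abs_self K))
  have hmix := rpow_mul_rpow_le_add (p := -(2 * δ)) (q := -2) ha hb (by linarith) (by norm_num)
  rw [show -(2 * δ) + -2 = -2 - 2 * δ by ring] at hmix
  have hpa := Real.rpow_pos_of_pos ha (-2 - 2 * δ)
  calc (b ^ (1 + δ) - a ^ (1 + δ)) ^ 2 / (a ^ (2 * δ) * b ^ (2 + 2 * δ))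
      ≤ 2 * (a ^ (2 * δ) + b ^ (2 * δ)) * K ^ 2 / (a ^ (2 * δ) * b ^ (2 + 2 * δ)) := by
        gcongr
        exact (sq_rpow_one_add_sub_le ha hb hδ hδ1).trans (by gcongr)
    _ = 2 * K ^ 2 * (b ^ (-2 - 2 * δ) + a ^ (-(2 * δ)) * b ^ (-2 : ℝ)) := by
        rw [show -2 - 2 * δ = -(2 + 2 * δ) by ring, Real.rpow_neg hb.le, Real.rpow_neg hb.le,
          Real.rpow_neg ha.le, Real.rpow_add hb]
        field_simp
    _ ≤ 2 * K ^ 2 * (2 * (a ^ (-2 - 2 * δ) + b ^ (-2 - 2 * δ))) := by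
        gcongr
        linarith
    _ = _ := by ring

lemma summable_znorm_rpow_mul_add {p q : ℝ} (hp : p < -2) (hq : q < -2) :
    Summable fun x : (ℤ × ℤ) × (ℤ × ℤ) =>
      znorm x.1 ^ p * (znorm x.2 ^ q + znorm (x.1 - x.2) ^ q) := by
  have hprod : Summable fun x : (ℤ × ℤ) × (ℤ × ℤ) => znorm x.1 ^ p * znorm x.2 ^ q :=
    (summable_znorm_rpow hp).mul_of_nonneg (summable_znorm_rpow hq)
      (fun k => Real.rpow_nonneg (znorm_nonneg k) _) fun k => Real.rpow_nonneg (znorm_nonneg k) _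
  have hinj : Function.Injective
      fun x : (ℤ × ℤ) × (ℤ × ℤ) => ((x.1, x.1 - x.2) : (ℤ × ℤ) × (ℤ × ℤ)) := by
    rintro ⟨k, h⟩ ⟨k', h'⟩ hx
    obtain ⟨rfl, hx⟩ := Prod.mk.inj hx
    exact congrArg (Prod.mk k) (sub_right_inj.mp hx)
  exact (hprod.add (hprod.comp_injective hinj)).congr fun x => (mul_add _ _ _).symm

/-- Appendix A: for `0 < δ ≤ 1` and `s < −2 + δ`, the family
`(k,h) ↦ ‖k‖^{2s−2δ}·((h^⊥·k)²/(‖h‖²‖k‖²))·(‖k−h‖^{1+δ} − ‖h‖^{1+δ})²/(‖h‖^{2δ}‖k−h‖^{2+2δ})`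
indexed by pairs `(k,h)` with `k ≠ 0`, `h ≠ 0`, `h ≠ k`, is summable. -/
theorem appendix_expectation_summable (δ s : ℝ) (hδ : 0 < δ) (hδ1 : δ ≤ 1)
    (hs : s < -2 + δ) :
    Summable (fun p : {p : (ℤ × ℤ) × (ℤ × ℤ) // p.1 ≠ 0 ∧ p.2 ≠ 0 ∧ p.2 ≠ p.1} =>
      znorm p.1.1 ^ (2 * s - 2 * δ)
        * (perpDot p.1.2 p.1.1 ^ 2 / (znorm p.1.2 ^ 2 * znorm p.1.1 ^ 2))
        * ((znorm (p.1.1 - p.1.2) ^ (1 + δ) - znorm p.1.2 ^ (1 + δ)) ^ 2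
          / (znorm p.1.2 ^ (2 * δ) * znorm (p.1.1 - p.1.2) ^ (2 + 2 * δ)))) := by
  have hmaj := ((summable_znorm_rpow_mul_add (p := 2 * s - 2 * δ + 2) (q := -2 - 2 * δ)
    (by linarith) (by linarith)).mul_left 4).comp_injective
    (Subtype.val_injective (p := fun p : (ℤ × ℤ) × (ℤ × ℤ) => p.1 ≠ 0 ∧ p.2 ≠ 0 ∧ p.2 ≠ p.1))
  refine hmaj.of_nonneg_of_le ?_ ?_
  · rintro ⟨⟨k, h⟩, -⟩
    have := znorm_nonneg k
    have := znorm_nonneg h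
    have := znorm_nonneg (k - h)
    positivity
  · rintro ⟨⟨k, h⟩, hk, hh, hhk⟩
    simp only [Function.comp_apply] at hk hh hhk ⊢
    have hk' := znorm_pos hk
    have hh' := znorm_pos hh
    have hkh' := znorm_pos (sub_ne_zero.mpr hhk.symm)
    calc _ ≤ znorm k ^ (2 * s - 2 * δ) * 1 * (4 * znorm k ^ 2 *
          (znorm h ^ (-2 - 2 * δ) + znorm (k - h) ^ (-2 - 2 * δ))) := by
          gcongr
          · exact div_le_one_of_le₀ (perpDot_sq_le h k) (by positivity)
          · exact sq_rpow_one_add_sub_div_le hh' hkh' hδ.le hδ1 (abs_znorm_sub_sub_znorm_le k h)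
      _ = _ := by
          rw [Real.rpow_add hk', Real.rpow_two]
          ring
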